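/- Let m and n be positive integers with mn ≡ 0 (mod 8) such that m and n are not both even, and let λ_a ∈ {2,3}. Then every (m,n,3,λ_a,1)-OOSPC has at most ⌊(7mn+16ω)/32⌋ codewords. -/

import Mathlib

open Finset

/-- An (m,n,k,lamA,lamC)-OOSPC: a family of k-subsets of Z_m x Z_n with
auto-correlation at most lamA and cross-correlation at most lamC. -/
def OOSPC (m n k lamA lamC : ℕ) (F : Finset (Finset (ZMod m × ZMod n))) : Prop :=
  (∀ X ∈ F, X.card = k) ∧
  (∀ X ∈ F, ∀ g : ZMod m × ZMod n, g ≠ 0 →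
    (X ∩ X.image (fun x => g + x)).card ≤ lamA) ∧
  (∀ X ∈ F, ∀ Y ∈ F, X ≠ Y → ∀ g : ZMod m × ZMod n,
    (X ∩ Y.image (fun x => g + x)).card ≤ lamC)

/-- The leave of a family: nonzero elements of Z_m x Z_n not occurring as a
difference of two elements of a member of the family. -/
def leave (m n : ℕ) (F : Finset (Finset (ZMod m × ZMod n))) : Set (ZMod m × ZMod n) :=
  {g | g ≠ 0 ∧ ∀ X ∈ F, ∀ x ∈ X, ∀ y ∈ X, x - y ≠ g}

/-- (s,t)-regularity: the leave together with 0 equals S × T, where S and T are the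
unique subgroups of order s of Z_m and of order t of Z_n (for s ∣ m, t ∣ n these are
exactly the elements killed by s, resp. t). -/
def Regular (m n s t : ℕ) (F : Finset (Finset (ZMod m × ZMod n))) : Prop :=
  insert (0 : ZMod m × ZMod n) (leave m n F) =
    {p : ZMod m × ZMod n | s • p.1 = 0 ∧ t • p.2 = 0}

/-- ξ: the number of subgroups of order 3 in Z_m × Z_n. -/
def xi (m n : ℕ) : ℕ := if 3 ∣ m ∧ 3 ∣ n then 4 else if 3 ∣ m * n then 1 else 0

/-- ω = 0 if lamA = 2, and ω = ξ if lamA = 3. -/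
def omega (lamA m n : ℕ) : ℕ := if lamA = 2 then 0 else xi m n

section DifferenceWeights

variable {G : Type*} [AddCommGroup G] [DecidableEq G]

/-- The set of differences of two distinct elements of `X`. -/
def diffSet (X : Finset G) : Finset G := X.offDiag.image fun p => p.1 - p.2

lemma sub_mem_diffSet {X : Finset G} {x y : G} (hx : x ∈ X) (hy : y ∈ X) (h : x ≠ y) :
    x - y ∈ diffSet X :=
  mem_image.2 ⟨(x, y), mem_offDiag.2 ⟨hx, hy, h⟩, rfl⟩

lemma neg_sub_mem_diffSet {X : Finset G} {x y : G} (hx : x ∈ X) (hy : y ∈ X) (h : x ≠ y) :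
    -(x - y) ∈ diffSet X := by
  rw [neg_sub]
  exact sub_mem_diffSet hy hx h.symm

/-- Weights on `ZMod 4`, doubled on average over a pair `±c`. -/
def baseWeight (c : ZMod 4) : ℕ := if c = 0 then 2 else if c = 2 then 3 else 1

/-- The weight on a group mapping to `ZMod 4`: an involution counts as a full `±` pair. -/
def diffWeight (φ : G →+ ZMod 4) (g : G) : ℕ :=
  if g = 0 then 0 else if 2 • g = 0 then 4 else baseWeight (φ g)

/-- `X` is invariant under translation by an element of order three. -/
def TripleInvariant (X : Finset G) : Prop := ∃ g : G, g ≠ 0 ∧ 3 • g = 0 ∧ ∀ x ∈ X, g + x ∈ X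

lemma baseWeight_neg (c : ZMod 4) : baseWeight (-c) = baseWeight c := by
  revert c; decide

lemma sum_diffWeight_pair (φ : G →+ ZMod 4) (hφ : ∀ g, 2 • g = 0 → φ g = 0) {g : G}
    (hg : g ≠ 0) : ∑ x ∈ {g, -g}, diffWeight φ x = 2 * baseWeight (φ g) := by
  by_cases h : 2 • g = 0
  · have hn : -g = g := by
      rw [neg_eq_iff_add_eq_zero, ← two_nsmul, h]
    simp [hn, diffWeight, hg, h, hφ g h, baseWeight]
  · have hn : g ≠ -g := fun e => h (by rw [two_nsmul]; exact eq_neg_iff_add_eq_zero.1 e)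
    rw [sum_pair hn]
    simp only [diffWeight, neg_eq_zero, hg, if_false, smul_neg, h, map_neg, baseWeight_neg]
    ring

lemma disjoint_pm_pair {a b : G} (h₁ : a ≠ b) (h₂ : a ≠ -b) :
    Disjoint ({a, -a} : Finset G) {b, -b} := by
  have h₃ : -a ≠ b := fun e => h₂ (by rw [← e, neg_neg])
  simp [h₁.symm, h₂.symm, h₃.symm]

/-- The case `a = b` of three differences `a, b, c` summing to zero. -/
lemma eight_le_sum_of_double (φ : G →+ ZMod 4) (hφ : ∀ g, 2 • g = 0 → φ g = 0)
    {D : Finset G} {a c : G} (ha : a ≠ 0) (hc : c ≠ 0) (hac : 2 • a + c = 0)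
    (haD : ({a, -a} : Finset G) ⊆ D) (hcD : ({c, -c} : Finset G) ⊆ D) (h3 : 3 • a ≠ 0) :
    8 ≤ ∑ g ∈ D, diffWeight φ g := by
  have hc' : c = -(2 • a) := (neg_eq_of_add_eq_zero_right hac).symm
  have h₁ : a ≠ c := fun e => h3 (by rw [succ_nsmul, ← hac, ← e])
  have h₂ : a ≠ -c := by
    intro e
    apply ha
    rw [hc', neg_neg, two_nsmul] at e
    simpa using e
  calc 8 ≤ 2 * baseWeight (φ a) + 2 * baseWeight (φ c) := by
        rw [hc', map_neg, map_nsmul]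
        generalize φ a = t
        revert t; decide
    _ = ∑ g ∈ {a, -a} ∪ {c, -c}, diffWeight φ g := by
        rw [sum_union (disjoint_pm_pair h₁ h₂), sum_diffWeight_pair φ hφ ha,
          sum_diffWeight_pair φ hφ hc]
    _ ≤ _ := sum_le_sum_of_subset (union_subset haD hcD)

/-- The generic case of three differences `a, b, c` summing to zero. -/
lemma eight_le_sum_of_distinct (φ : G →+ ZMod 4) (hφ : ∀ g, 2 • g = 0 → φ g = 0)
    {D : Finset G} {a b c : G} (ha : a ≠ 0) (hb : b ≠ 0) (hc : c ≠ 0) (habc : a + b + c = 0)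
    (hab : a ≠ b) (hbc : b ≠ c) (hac : a ≠ c)
    (haD : ({a, -a} : Finset G) ⊆ D) (hbD : ({b, -b} : Finset G) ⊆ D)
    (hcD : ({c, -c} : Finset G) ⊆ D) : 8 ≤ ∑ g ∈ D, diffWeight φ g := by
  have hab' : a ≠ -b := fun e => hc (by simpa [e] using habc)
  have hbc' : b ≠ -c := fun e => ha (by simpa [e] using habc)
  have hac' : a ≠ -c := fun e => hb (by simpa [e] using habc)
  have hd : Disjoint ({a, -a} ∪ {b, -b} : Finset G) {c, -c} :=
    disjoint_union_left.2 ⟨disjoint_pm_pair hac hac', disjoint_pm_pair hbc hbc'⟩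
  have hφc : φ c = -(φ a + φ b) := by
    rw [← map_add, ← map_neg, neg_eq_of_add_eq_zero_right habc]
  calc 8 ≤ 2 * baseWeight (φ a) + 2 * baseWeight (φ b) + 2 * baseWeight (φ c) := by
        rw [hφc]
        generalize φ a = s
        generalize φ b = t
        revert s t; decide
    _ = ∑ g ∈ {a, -a} ∪ {b, -b} ∪ {c, -c}, diffWeight φ g := by
        rw [sum_union hd, sum_union (disjoint_pm_pair hab hab'), sum_diffWeight_pair φ hφ ha,
          sum_diffWeight_pair φ hφ hb, sum_diffWeight_pair φ hφ hc]
    _ ≤ _ := sum_le_sum_of_subset (union_subset (union_subset haD hbD) hcD)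

lemma four_le_sum (φ : G →+ ZMod 4) (hφ : ∀ g, 2 • g = 0 → φ g = 0)
    {D : Finset G} {a : G} (ha : a ≠ 0) (h3 : 3 • a = 0) (haD : ({a, -a} : Finset G) ⊆ D) :
    4 ≤ ∑ g ∈ D, diffWeight φ g := by
  have h0 : φ a = 0 := by
    have := congrArg φ h3
    rw [map_nsmul, map_zero] at this
    revert this
    generalize φ a = t
    revert t; decide
  calc 4 = 2 * baseWeight (φ a) := by rw [h0]; rfl
    _ = _ := (sum_diffWeight_pair φ hφ ha).symm
    _ ≤ _ := sum_le_sum_of_subset haD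

open Classical in
lemma eight_le_sum_diffSet (φ : G →+ ZMod 4) (hφ : ∀ g, 2 • g = 0 → φ g = 0)
    {X : Finset G} (hX : X.card = 3) :
    8 ≤ ∑ g ∈ diffSet X, diffWeight φ g + if TripleInvariant X then 4 else 0 := by
  obtain ⟨x, y, z, hxy, hxz, hyz, rfl⟩ := card_eq_three.1 hX
  set X : Finset G := {x, y, z} with hXdef
  have hx : x ∈ X := by simp [hXdef]
  have hy : y ∈ X := by simp [hXdef]
  have hz : z ∈ X := by simp [hXdef]
  have pairs : ∀ {s t : G}, s ∈ X → t ∈ X → s ≠ t → ({s - t, -(s - t)} : Finset G) ⊆ diffSet X :=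
    fun hs ht h => insert_subset (sub_mem_diffSet hs ht h)
      (singleton_subset_iff.2 (neg_sub_mem_diffSet hs ht h))
  have ha := pairs hx hy hxy
  have hb := pairs hy hz hyz
  have hc := pairs hz hx hxz.symm
  have ha0 := sub_ne_zero.2 hxy
  have hb0 := sub_ne_zero.2 hyz
  have hc0 := sub_ne_zero.2 hxz.symm
  have hsum : (x - y) + (y - z) + (z - x) = 0 := by abel
  have hinv : x - y = y - z → 3 • (x - y) = 0 → TripleInvariant X := by
    intro hab h3
    refine ⟨x - y, ha0, h3, ?_⟩
    have h₁ : x - y + y = x := by abel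
    have h₂ : x - y + z = y := by rw [hab]; abel
    have h₃ : x - y + x = z := by
      have : x - y + x = 3 • (x - y) - (y - z - (y - z)) + (z - ((x - y) - (y - z))) := by abel
      rw [this, h3, hab]; abel
    intro w hw
    simp only [hXdef, mem_insert, mem_singleton] at hw ⊢
    rcases hw with rfl | rfl | rfl
    · exact Or.inr (Or.inr h₃)
    · exact Or.inl h₁
    · exact Or.inr (Or.inl h₂)
  by_cases h : x - y = y - z ∧ 3 • (x - y) = 0
  · rw [if_pos (hinv h.1 h.2)]
    have := four_le_sum φ hφ ha0 h.2 ha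
    omega
  refine le_trans ?_ (Nat.le_add_right _ _)
  have key : ∀ {a b c : G}, a + b + c = 0 → a = b → 3 • a = 0 → c = a := by
    rintro a b c hs rfl h3
    rw [succ_nsmul, two_nsmul] at h3
    exact add_left_cancel (hs.trans h3.symm)
  by_cases hab : x - y = y - z
  · refine eight_le_sum_of_double φ hφ ha0 hc0 ?_ ha hc (fun h3 => h ⟨hab, h3⟩)
    rw [two_nsmul]; nth_rw 2 [hab]; exact hsum
  by_cases hbc : y - z = z - x
  · refine eight_le_sum_of_double φ hφ hb0 ha0 ?_ hb ha (fun h3 => hab ?_)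
    · rw [two_nsmul]; nth_rw 2 [hbc]; abel
    · exact key (by abel) hbc h3
  by_cases hac : x - y = z - x
  · refine eight_le_sum_of_double φ hφ ha0 hb0 ?_ ha hb (fun h3 => hab ?_)
    · rw [two_nsmul]; nth_rw 2 [hac]; abel
    · exact (key (by abel) hac h3).symm
  exact eight_le_sum_of_distinct φ hφ ha0 hb0 hc0 hsum hab hbc hac ha hb hc

lemma disjoint_diffSet {X Y : Finset G}
    (h : ∀ g : G, (X ∩ Y.image (fun x => g + x)).card ≤ 1) :
    Disjoint (diffSet X) (diffSet Y) := by
  rw [disjoint_left]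
  intro d hdX hdY
  simp only [diffSet, mem_image, mem_offDiag, Prod.exists] at hdX hdY
  obtain ⟨x, x', ⟨hx, hx', hne⟩, hd⟩ := hdX
  obtain ⟨y, y', ⟨hy, hy', -⟩, hd'⟩ := hdY
  refine hne (card_le_one.1 (h (x - y)) x ?_ x' ?_)
  · exact mem_inter.2 ⟨hx, mem_image.2 ⟨y, hy, by abel⟩⟩
  · refine mem_inter.2 ⟨hx', mem_image.2 ⟨y', hy', ?_⟩⟩
    have : x - y + y' = x - (y - y') := by abel
    rw [this, hd', ← hd]; abel

variable [Fintype G]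

lemma four_mul_sum_baseWeight {A : Type*} [AddCommGroup A] [Fintype A] (φ : A →+ ZMod 4)
    (hs : Function.Surjective φ) : 4 * ∑ g, baseWeight (φ g) = 7 * Fintype.card A := by
  set k := (univ.filter fun g => φ g = 0).card
  have hfib : ∀ c : ZMod 4, (univ.filter fun g => φ g = c).card = k := fun c =>
    AddMonoidHom.card_fiber_eq_of_mem_range φ (hs c) (hs 0)
  have h₁ : ∑ g, baseWeight (φ g) = ∑ c, k * baseWeight c := by
    rw [← sum_fiberwise univ φ]
    refine sum_congr rfl fun c _ => ?_
    rw [sum_congr rfl (g := fun _ => baseWeight c), sum_const, hfib, smul_eq_mul]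
    intro g hg
    rw [(mem_filter.1 hg).2]
  have h₂ : Fintype.card A = 4 * k := by
    rw [← card_univ, card_eq_sum_card_fiberwise (f := φ) (t := univ) (by simp)]
    simp [hfib, ZMod.card]
  have h₃ : ∑ c, baseWeight c = 7 := by decide
  rw [h₁, ← mul_sum, h₂, h₃]
  ring

lemma four_mul_sum_diffWeight_le (φ : G →+ ZMod 4) (hs : Function.Surjective φ)
    (hφ : ∀ g, 2 • g = 0 → φ g = 0) (h2 : (univ.filter fun g : G => 2 • g = 0).card ≤ 2) :
    4 * ∑ g, diffWeight φ g ≤ 7 * Fintype.card G := by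
  have h : ∑ g, (diffWeight φ g + if g = 0 then 4 else 0) =
      ∑ g, (baseWeight (φ g) + if 2 • g = 0 then 2 else 0) := by
    refine sum_congr rfl fun g _ => ?_
    by_cases h0 : g = 0
    · simp [h0, diffWeight, baseWeight]
    · by_cases h : 2 • g = 0
      · simp [h0, h, diffWeight, baseWeight, hφ g h]
      · simp [h0, h, diffWeight]
  rw [sum_add_distrib, sum_add_distrib, sum_ite_eq' univ (0 : G), ← sum_filter, sum_const,
    smul_eq_mul] at h
  have := four_mul_sum_baseWeight φ hs
  simp only [mem_univ, if_true] at h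
  omega

open Classical in
/-- Counting bound for triples with pairwise disjoint difference sets in a group mapping onto
`ZMod 4` with at most one involution. -/
lemma card_le_of_disjoint_diffSets (φ : G →+ ZMod 4) (hs : Function.Surjective φ)
    (hφ : ∀ g, 2 • g = 0 → φ g = 0) (h2 : (univ.filter fun g : G => 2 • g = 0).card ≤ 2)
    (F : Finset (Finset G)) (h3 : ∀ X ∈ F, X.card = 3)
    (hd : (F : Set (Finset G)).PairwiseDisjoint diffSet) :
    32 * F.card ≤ 7 * Fintype.card G + 16 * (F.filter TripleInvariant).card := by
  have h₁ : F.card * 8 ≤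
      ∑ X ∈ F, (∑ g ∈ diffSet X, diffWeight φ g + if TripleInvariant X then 4 else 0) :=
    card_nsmul_le_sum _ _ _ fun X hX => eight_le_sum_diffSet φ hφ (h3 X hX)
  rw [sum_add_distrib, ← sum_biUnion hd, ← sum_filter, sum_const, smul_eq_mul] at h₁
  change _ ≤ _ + (F.filter TripleInvariant).card * 4 at h₁
  have h₂ : ∑ g ∈ F.biUnion diffSet, diffWeight φ g ≤ ∑ g, diffWeight φ g :=
    sum_le_sum_of_subset (subset_univ _)
  have := four_mul_sum_diffWeight_le φ hs hφ h2
  omega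

open Classical in
lemma two_mul_card_tripleInvariant_lt (F : Finset (Finset G)) (h3 : ∀ X ∈ F, X.card = 3)
    (hd : (F : Set (Finset G)).PairwiseDisjoint diffSet) :
    2 * (F.filter TripleInvariant).card < (univ.filter fun g : G => 3 • g = 0).card := by
  set K := univ.filter fun g : G => 3 • g = 0 with hK
  have h0 : (0 : G) ∈ K := by simp [hK]
  have hsub : (F.filter TripleInvariant).biUnion (fun X => diffSet X ∩ K) ⊆ K.erase 0 := by
    intro d h
    obtain ⟨X, -, h⟩ := mem_biUnion.1 h
    obtain ⟨h, hdK⟩ := mem_inter.1 h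
    refine mem_erase.2 ⟨?_, hdK⟩
    rintro rfl
    obtain ⟨⟨x, y⟩, h, he⟩ := mem_image.1 h
    exact (mem_offDiag.1 h).2.2 (sub_eq_zero.1 he)
  have hcard := card_le_card hsub
  rw [card_biUnion, card_erase_of_mem h0] at hcard
  · have h₁ : (F.filter TripleInvariant).card * 2 ≤
        ∑ X ∈ F.filter TripleInvariant, (diffSet X ∩ K).card := by
      refine card_nsmul_le_sum _ (fun X => (diffSet X ∩ K).card) 2 fun X hX => ?_
      obtain ⟨hXF, g, hg0, hg3, hg⟩ := mem_filter.1 hX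
      obtain ⟨x, hx⟩ : X.Nonempty := by
        rw [← card_pos, h3 X hXF]; norm_num
      have hne : g + x ≠ x := by simpa using hg0
      have h₁ : g ∈ diffSet X := by simpa using sub_mem_diffSet (hg x hx) hx hne
      have h₂ : -g ∈ diffSet X := by simpa using neg_sub_mem_diffSet (hg x hx) hx hne
      have hgn : g ≠ -g := by
        intro e
        have : 2 • g = 0 := by rw [two_nsmul]; exact eq_neg_iff_add_eq_zero.1 e
        rw [succ_nsmul, this, zero_add] at hg3
        exact hg0 hg3
      rw [← card_pair hgn]
      refine card_le_card (insert_subset ?_ (singleton_subset_iff.2 ?_))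
      · simp [h₁, hK, hg3]
      · simp [h₂, hK, hg3]
    have := card_pos.2 ⟨0, h0⟩
    omega
  · intro X hX Y hY hXY
    exact (hd (mem_filter.1 hX).1 (mem_filter.1 hY).1 hXY).mono inter_subset_left
      inter_subset_left

end DifferenceWeights

lemma ZMod.card_nsmul_eq_zero_le (m k : ℕ) [NeZero m] (hk : 0 < k) :
    (univ.filter fun x : ZMod m => k • x = 0).card ≤ k :=
  IsAddCyclic.card_nsmul_eq_zero_le hk

lemma ZMod.eq_zero_of_nsmul_eq_zero {m k : ℕ} (h : Nat.Coprime k m) {x : ZMod m}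
    (hx : k • x = 0) : x = 0 := by
  rw [nsmul_eq_mul] at hx
  exact ((ZMod.isUnit_iff_coprime k m).2 h).mul_right_eq_zero.1 hx

lemma ZMod.card_nsmul_eq_zero_of_coprime {m k : ℕ} [NeZero m] (h : Nat.Coprime k m) :
    (univ.filter fun x : ZMod m => k • x = 0).card ≤ 1 :=
  card_le_one.2 fun x hx y hy => by
    rw [ZMod.eq_zero_of_nsmul_eq_zero h (mem_filter.1 hx).2,
      ZMod.eq_zero_of_nsmul_eq_zero h (mem_filter.1 hy).2]

lemma card_prod_nsmul_eq_zero {A B : Type*} [AddCommGroup A] [AddCommGroup B] [Fintype A]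
    [Fintype B] [DecidableEq A] [DecidableEq B] (k : ℕ) :
    (univ.filter fun g : A × B => k • g = 0).card =
      (univ.filter fun x : A => k • x = 0).card * (univ.filter fun y : B => k • y = 0).card := by
  rw [← card_product]
  congr 1
  ext ⟨x, y⟩
  simp [Prod.ext_iff]

lemma ZMod.castHom_eq_zero_of_two_nsmul {m : ℕ} [NeZero m] (h8 : 8 ∣ m) (h4 : 4 ∣ m) {x : ZMod m}
    (hx : 2 • x = 0) : ZMod.castHom h4 (ZMod 4) x = 0 := by
  rw [← ZMod.natCast_zmod_val x] at hx ⊢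
  rw [map_natCast, ZMod.natCast_eq_zero_iff]
  rw [nsmul_eq_mul, ← Nat.cast_mul, ZMod.natCast_eq_zero_iff] at hx
  have := h8.trans hx
  omega

lemma eight_dvd_of_odd_right {m n : ℕ} (h : m * n % 8 = 0) (hn : ¬ 2 ∣ n) : 8 ∣ m :=
  (Nat.Coprime.pow_left 3 ((Nat.Prime.coprime_iff_not_dvd Nat.prime_two).2 hn)).dvd_of_dvd_mul_right
    (Nat.dvd_of_mod_eq_zero h)

lemma exists_hom_zmod_four {m n : ℕ} [NeZero m] [NeZero n] (h8 : m * n % 8 = 0)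
    (hpar : ¬ (2 ∣ m ∧ 2 ∣ n)) :
    ∃ φ : ZMod m × ZMod n →+ ZMod 4, Function.Surjective φ ∧ ∀ g, 2 • g = 0 → φ g = 0 := by
  by_cases hn : 2 ∣ n
  · have h : 8 ∣ n := eight_dvd_of_odd_right (by rwa [mul_comm]) fun hm => hpar ⟨hm, hn⟩
    have h4 : 4 ∣ n := (by norm_num : 4 ∣ 8).trans h
    exact ⟨(ZMod.castHom h4 (ZMod 4)).toAddMonoidHom.comp (AddMonoidHom.snd _ _),
      (ZMod.castHom_surjective h4).comp Prod.snd_surjective,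
      fun g hg => ZMod.castHom_eq_zero_of_two_nsmul h h4 (congrArg Prod.snd hg)⟩
  · have h : 8 ∣ m := eight_dvd_of_odd_right h8 hn
    have h4 : 4 ∣ m := (by norm_num : 4 ∣ 8).trans h
    exact ⟨(ZMod.castHom h4 (ZMod 4)).toAddMonoidHom.comp (AddMonoidHom.fst _ _),
      (ZMod.castHom_surjective h4).comp Prod.fst_surjective,
      fun g hg => ZMod.castHom_eq_zero_of_two_nsmul h h4 (congrArg Prod.fst hg)⟩

lemma card_two_nsmul_eq_zero_le {m n : ℕ} [NeZero m] [NeZero n] (hpar : ¬ (2 ∣ m ∧ 2 ∣ n)) :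
    (univ.filter fun g : ZMod m × ZMod n => 2 • g = 0).card ≤ 2 := by
  have hcop : ∀ {k : ℕ}, ¬ 2 ∣ k → Nat.Coprime 2 k := fun h =>
    (Nat.Prime.coprime_iff_not_dvd Nat.prime_two).2 h
  rw [card_prod_nsmul_eq_zero]
  by_cases hn : 2 ∣ n
  · exact Nat.mul_le_mul (ZMod.card_nsmul_eq_zero_of_coprime (hcop fun hm => hpar ⟨hm, hn⟩))
      (ZMod.card_nsmul_eq_zero_le n 2 two_pos)
  · exact Nat.mul_le_mul (ZMod.card_nsmul_eq_zero_le m 2 two_pos)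
      (ZMod.card_nsmul_eq_zero_of_coprime (hcop hn))

lemma card_three_nsmul_eq_zero_le (m n : ℕ) [NeZero m] [NeZero n] :
    (univ.filter fun g : ZMod m × ZMod n => 3 • g = 0).card ≤ 2 * xi m n + 1 := by
  have hcop : ∀ {k : ℕ}, ¬ 3 ∣ k → Nat.Coprime 3 k := fun h =>
    (Nat.Prime.coprime_iff_not_dvd Nat.prime_three).2 h
  have hm := ZMod.card_nsmul_eq_zero_le m 3 three_pos
  have hn := ZMod.card_nsmul_eq_zero_le n 3 three_pos
  rw [card_prod_nsmul_eq_zero]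
  by_cases h₁ : 3 ∣ m <;> by_cases h₂ : 3 ∣ n <;>
    simp only [xi, Nat.prime_three.dvd_mul, h₁, h₂, and_true, and_false, or_true, or_false,
      if_true, if_false]
  · exact Nat.mul_le_mul hm hn
  · exact Nat.mul_le_mul hm (ZMod.card_nsmul_eq_zero_of_coprime (hcop h₂))
  · exact Nat.mul_le_mul (ZMod.card_nsmul_eq_zero_of_coprime (hcop h₁)) hn
  · exact Nat.mul_le_mul (ZMod.card_nsmul_eq_zero_of_coprime (hcop h₁))
      (ZMod.card_nsmul_eq_zero_of_coprime (hcop h₂))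

theorem stmt4 (m n lamA : ℕ) (hm : 0 < m) (hn : 0 < n)
    (h8 : m * n % 8 = 0) (hpar : ¬ (2 ∣ m ∧ 2 ∣ n))
    (hl : lamA = 2 ∨ lamA = 3)
    (F : Finset (Finset (ZMod m × ZMod n))) (hF : OOSPC m n 3 lamA 1 F) :
    F.card ≤ (7 * m * n + 16 * omega lamA m n) / 32 := by
  classical
  have : NeZero m := ⟨hm.ne'⟩
  have : NeZero n := ⟨hn.ne'⟩
  obtain ⟨h3, hauto, hcross⟩ := hF
  have hd : (F : Set (Finset (ZMod m × ZMod n))).PairwiseDisjoint diffSet :=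
    fun X hX Y hY hXY => disjoint_diffSet (hcross X hX Y hY hXY)
  obtain ⟨φ, hs, hφ⟩ := exists_hom_zmod_four h8 hpar
  have hmain := card_le_of_disjoint_diffSets φ hs hφ (card_two_nsmul_eq_zero_le hpar) F h3 hd
  have homega : (F.filter TripleInvariant).card ≤ omega lamA m n := by
    rcases hl with rfl | rfl
    · rw [filter_false_of_mem]
      · simp
      rintro X hX ⟨g, hg0, -, hg⟩
      have hsub : X.image (fun x => g + x) ⊆ X := image_subset_iff.2 hg
      have := hauto X hX g hg0
      rw [inter_eq_right.2 hsub, card_image_of_injective _ (add_right_injective g), h3 X hX] at this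
      omega
    · have h₁ := two_mul_card_tripleInvariant_lt F h3 hd
      have h₂ := card_three_nsmul_eq_zero_le m n
      simp only [omega, show ¬ (3 = 2) by decide, if_false]
      omega
  rw [Fintype.card_prod, ZMod.card, ZMod.card, ← mul_assoc] at hmain
  rw [Nat.le_div_iff_mul_le (by norm_num)]
  omega
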